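/- Let ϑ > 0, η > 0, and ζ ∈ ℝ. The function f : (0, ∞) → ℝ defined by f(θ) = ζ²/(2θ) + θ/ϑ − η·log(θ/ϑ) attains its global minimum at a unique point, namely θ* = ( ηϑ + √( η²ϑ² + 2ϑζ² ) ) / 2, and f(θ*) ≤ f(θ) with equality only at θ = θ* for all θ > 0. -/

import Mathlib

/-- A positive solution of the stationarity equation `t² = ηϑt + ϑζ²/2` is the strict global
minimizer over `(0, ∞)` of `θ ↦ ζ²/(2θ) + θ/ϑ − η·log(θ/ϑ)`. -/
theorem gamma_objective_lt_of_stationary {ϑ η ζ t θ : ℝ} (hϑ : 0 < ϑ) (hη : 0 < η) (ht : 0 < t)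
    (hstat : t ^ 2 = η * ϑ * t + ϑ * ζ ^ 2 / 2) (hθ : 0 < θ) (hne : θ ≠ t) :
    ζ ^ 2 / (2 * t) + t / ϑ - η * Real.log (t / ϑ)
      < ζ ^ 2 / (2 * θ) + θ / ϑ - η * Real.log (θ / ϑ) := by
  have hlog : η * Real.log (θ / t) < η * (θ / t - 1) := by
    refine mul_lt_mul_of_pos_left (Real.log_lt_sub_one_of_pos (by positivity) ?_) hη
    rwa [Ne, div_eq_one_iff_eq ht.ne']
  have hinv : 1 / ϑ = η / t + ζ ^ 2 / (2 * t ^ 2) := by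
    field_simp
    linarith
  have hdiff : ζ ^ 2 / (2 * θ) + θ / ϑ - (ζ ^ 2 / (2 * t) + t / ϑ) - η * (θ / t - 1)
      = ζ ^ 2 * (θ - t) ^ 2 / (2 * t ^ 2 * θ) := by
    rw [div_eq_mul_one_div θ ϑ, div_eq_mul_one_div t ϑ, hinv]
    field_simp
    ring
  have hnonneg : 0 ≤ ζ ^ 2 * (θ - t) ^ 2 / (2 * t ^ 2 * θ) := by positivity
  rw [Real.log_div hθ.ne' ht.ne'] at hlog
  rw [Real.log_div hθ.ne' hϑ.ne', Real.log_div ht.ne' hϑ.ne']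
  linarith

/-- Closed-form θ-update for the gamma hyperprior (`r = 1`): the function
`f(θ) = ζ²/(2θ) + θ/ϑ − η·log(θ/ϑ)` on `(0,∞)` attains its global minimum at the
unique point `θ* = (ηϑ + √(η²ϑ² + 2ϑζ²))/2`. -/
theorem stmt_4 (ϑ η ζ : ℝ) (hϑ : 0 < ϑ) (hη : 0 < η) :
    0 < (η * ϑ + Real.sqrt (η ^ 2 * ϑ ^ 2 + 2 * ϑ * ζ ^ 2)) / 2 ∧
    ∀ θ : ℝ, 0 < θ →
      θ ≠ (η * ϑ + Real.sqrt (η ^ 2 * ϑ ^ 2 + 2 * ϑ * ζ ^ 2)) / 2 →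
      ζ ^ 2 / (2 * ((η * ϑ + Real.sqrt (η ^ 2 * ϑ ^ 2 + 2 * ϑ * ζ ^ 2)) / 2))
          + ((η * ϑ + Real.sqrt (η ^ 2 * ϑ ^ 2 + 2 * ϑ * ζ ^ 2)) / 2) / ϑ
          - η * Real.log (((η * ϑ + Real.sqrt (η ^ 2 * ϑ ^ 2 + 2 * ϑ * ζ ^ 2)) / 2) / ϑ)
        < ζ ^ 2 / (2 * θ) + θ / ϑ - η * Real.log (θ / ϑ) := by
  have hsq := Real.sq_sqrt (show 0 ≤ η ^ 2 * ϑ ^ 2 + 2 * ϑ * ζ ^ 2 by positivity)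
  have hpos : 0 < (η * ϑ + Real.sqrt (η ^ 2 * ϑ ^ 2 + 2 * ϑ * ζ ^ 2)) / 2 := by positivity
  refine ⟨hpos, fun θ hθ hne => gamma_objective_lt_of_stationary hϑ hη hpos ?_ hθ hne⟩
  linear_combination hsq / 4
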